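/- Loop measure representation of λ-LWW: let λ = (λ_η) be nonnegative loop activities satisfying the symmetry assumption and let z ≥ 0. For every self-avoiding walk η on ℤ^d, the following identity holds in [0,∞] (with exp(∞) = ∞): w̄_{λ,z}(η) = Σ_{walks ω with LE(ω) = η} w_{λ,z}(ω) = z^{|η|} · exp(μ_{λ,z}(range(η))). -/

import Mathlib

open scoped ENNReal NNReal BigOperators Classical

noncomputable section

namespace LWW

/-- A point of the lattice ℤ^d. -/
abbrev Pt (d : ℕ) := Fin d → ℤ

/-- ℓ¹ distance on ℤ^d. -/
def dist1 {d : ℕ} (x y : Pt d) : ℕ := ∑ i, (x i - y i).natAbs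

/-- Nearest-neighbour adjacency on ℤ^d. -/
def Adj {d : ℕ} (x y : Pt d) : Prop := dist1 x y = 1

/-- Auxiliary function for single loop erasure: scan the list, keeping the
self-avoiding prefix `pre`; when the first repeated vertex is met, return the
loop-erased list together with the removed loop. -/
def le1Aux {α : Type*} [DecidableEq α] : List α → List α → List α × Option (List α)
  | pre, [] => (pre, none)
  | pre, x :: rest =>
    if x ∈ pre then
      (pre.takeWhile (fun y => y ≠ x) ++ x :: rest,
        some (pre.dropWhile (fun y => y ≠ x) ++ [x]))
    else le1Aux (pre ++ [x]) rest

/-- Single loop erasure LE¹. -/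
def LE1 {α : Type*} [DecidableEq α] (l : List α) : List α := (le1Aux [] l).1

/-- The loop removed by a single loop erasure (if the list is not self-avoiding). -/
def removedLoop {α : Type*} [DecidableEq α] (l : List α) : Option (List α) := (le1Aux [] l).2

/-- Iterate single loop erasure (with fuel), collecting the multiset of removed loops. -/
def leAux {α : Type*} [DecidableEq α] : ℕ → List α → List α × Multiset (List α)
  | 0, l => (l, 0)
  | n + 1, l =>
    match le1Aux ([] : List α) l with
    | (_, none) => (l, 0)
    | (l', some c) => ((leAux n l').1, c ::ₘ (leAux n l').2)

/-- Loop erasure LE. -/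
def LE {α : Type*} [DecidableEq α] (l : List α) : List α := (leAux l.length l).1

/-- The multiset of loops removed by loop erasure. -/
def erasedLoops {α : Type*} [DecidableEq α] (l : List α) : Multiset (List α) :=
  (leAux l.length l).2

/-- The number of loops removed by loop erasure. -/
def nLoops {α : Type*} [DecidableEq α] (l : List α) : ℕ := Multiset.card (erasedLoops l)

/-- A (finite) nearest-neighbour walk on ℤ^d, recorded as its (nonempty) list of vertices. -/
structure Walk (d : ℕ) where
  pts : List (Pt d)
  ne : pts ≠ []
  chain : pts.Chain' Adj

namespace Walk

variable {d : ℕ}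

/-- The number of steps of a walk. -/
def len (ω : Walk d) : ℕ := ω.pts.length - 1

/-- The initial vertex of a walk. -/
def start (ω : Walk d) : Pt d := ω.pts.headI

/-- The final vertex of a walk. -/
def finish (ω : Walk d) : Pt d := ω.pts.getLastD default

/-- The range (set of visited vertices) of a walk. -/
def range (ω : Walk d) : Set (Pt d) := {x | x ∈ ω.pts}

/-- The `i`-th vertex of a walk. -/
def nth (ω : Walk d) (i : ℕ) : Pt d := ω.pts.getD i default

/-- A walk is a loop if it has at least one step and ends where it began. -/
def IsLoop (ω : Walk d) : Prop := 1 ≤ ω.len ∧ ω.finish = ω.start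

end Walk

/-- The list of vertices of a self-avoiding polygon: a closed nearest-neighbour
walk all of whose vertices are distinct except that the last equals the first. -/
def IsSAPList {d : ℕ} (l : List (Pt d)) : Prop :=
  l.Chain' Adj ∧ 3 ≤ l.length ∧ l.getLastD default = l.headI ∧ l.dropLast.Nodup

/-- Change the initial vertex of a polygon list by a cyclic rotation. -/
def polyRot {d : ℕ} (l : List (Pt d)) (r : ℕ) : List (Pt d) :=
  l.dropLast.rotate r ++ [(l.dropLast.rotate r).headI]

/-- An isometry of the lattice ℤ^d: a bijection preserving ℓ¹ distance. -/
def IsLatticeIso {d : ℕ} (R : Pt d ≃ Pt d) : Prop :=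
  ∀ x y : Pt d, dist1 (R x) (R y) = dist1 x y

/-- The symmetry assumption on the loop activities: invariance under isometries of ℤ^d
and under change of initial vertex and of orientation of the polygon. -/
def SymmAssumption {d : ℕ} (lam : List (Pt d) → ℝ≥0) : Prop :=
  (∀ R : Pt d ≃ Pt d, IsLatticeIso R → ∀ l : List (Pt d), IsSAPList l →
      lam (l.map R) = lam l) ∧
  (∀ l : List (Pt d), IsSAPList l → ∀ r : ℕ, lam (polyRot l r) = lam l) ∧
  (∀ l : List (Pt d), IsSAPList l → lam l.reverse = lam l)

/-- The boundedness assumption: sup over self-avoiding polygons of the activity is finite. -/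
def BoundedAssumption {d : ℕ} (lam : List (Pt d) → ℝ≥0) : Prop :=
  ∃ M : ℝ≥0, ∀ l : List (Pt d), IsSAPList l → lam l ≤ M

/-- The product of the loop activities over the loops erased from `ω`, i.e. λ^{n_L(ω)}. -/
def wt0 {d : ℕ} (lam : List (Pt d) → ℝ≥0) (ω : Walk d) : ℝ≥0∞ :=
  ((erasedLoops ω.pts).map (fun η => (lam η : ℝ≥0∞))).prod

/-- The λ-LWW weight w_{λ,z}(ω) = z^{|ω|} λ^{n_L(ω)}. -/
def wt {d : ℕ} (lam : List (Pt d) → ℝ≥0) (z : ℝ≥0) (ω : Walk d) : ℝ≥0∞ :=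
  (z : ℝ≥0∞) ^ ω.len * wt0 lam ω

/-- The λ-LWW two-point function. -/
def G {d : ℕ} (lam : List (Pt d) → ℝ≥0) (z : ℝ≥0) (x y : Pt d) : ℝ≥0∞ :=
  ∑' ω : Walk d, if ω.start = x ∧ ω.finish = y then wt lam z ω else 0

/-- The λ-LWW loop measure μ_{λ,z}(A;B). -/
def mu {d : ℕ} (lam : List (Pt d) → ℝ≥0) (z : ℝ≥0) (A B : Set (Pt d)) : ℝ≥0∞ :=
  ∑' ω : Walk d,
    if ω.IsLoop ∧ (ω.range ∩ A).Nonempty ∧ ω.range ∩ B = ∅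
    then wt lam z ω / (ω.len : ℝ≥0∞) else 0

/-- The generalized λ-LWW loop measure μ_{λ,z}(A,B;C) with two hitting sets. -/
def mu2 {d : ℕ} (lam : List (Pt d) → ℝ≥0) (z : ℝ≥0) (A B C : Set (Pt d)) : ℝ≥0∞ :=
  ∑' ω : Walk d,
    if ω.IsLoop ∧ (ω.range ∩ A).Nonempty ∧ (ω.range ∩ B).Nonempty ∧ ω.range ∩ C = ∅
    then wt lam z ω / (ω.len : ℝ≥0∞) else 0

/-- exp : [0,∞] → [0,∞] with exp(∞) = ∞. -/
def eexp (x : ℝ≥0∞) : ℝ≥0∞ := if x = ⊤ then ⊤ else ENNReal.ofReal (Real.exp x.toReal)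

/-- The loop-erased λ-LWW weight w̄_{λ,z}(η) of a self-avoiding walk η. -/
def wbar {d : ℕ} (lam : List (Pt d) → ℝ≥0) (z : ℝ≥0) (η : Walk d) : ℝ≥0∞ :=
  ∑' ω : Walk d, if LE ω.pts = η.pts then wt lam z ω else 0

/-- c_n^λ : the total λ-LWW mass of n-step walks started at the origin. -/
def cN {d : ℕ} (lam : List (Pt d) → ℝ≥0) (n : ℕ) : ℝ≥0∞ :=
  ∑' ω : Walk d, if ω.start = 0 ∧ ω.len = n then wt0 lam ω else 0

/-- The susceptibility χ_λ(z) = Σ_n c_n^λ z^n. -/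
def chi {d : ℕ} (lam : List (Pt d) → ℝ≥0) (z : ℝ) : ℝ≥0∞ :=
  ∑' n : ℕ, cN lam n * ENNReal.ofReal z ^ n

/-- The critical point z_c(λ): the radius of convergence of the susceptibility
(for a power series with nonnegative coefficients this is the supremum of the
set of nonnegative z at which the series converges). -/
def zc {d : ℕ} (lam : List (Pt d) → ℝ≥0) : ℝ :=
  sSup {z : ℝ | 0 ≤ z ∧ chi lam z < ⊤}

section LoopErasure

variable {α : Type*} [DecidableEq α]

theorem le1Aux_append_of_none (pre l r : List α) (h : (le1Aux pre l).2 = none) :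
    le1Aux pre (l ++ r) = le1Aux (pre ++ l) r := by
  induction l generalizing pre with
  | nil => simp
  | cons x l ih =>
    by_cases hx : x ∈ pre
    · simp [le1Aux, hx] at h
    · simp only [le1Aux, hx, if_false] at h
      simp only [List.cons_append, le1Aux, hx, if_false]
      rw [ih _ h]
      simp

theorem nodup_of_le1Aux_none (pre l : List α) (hpre : pre.Nodup) (h : (le1Aux pre l).2 = none) :
    (pre ++ l).Nodup := by
  induction l generalizing pre with
  | nil => simpa
  | cons x l ih =>
    by_cases hx : x ∈ pre
    · simp [le1Aux, hx] at h
    · simp only [le1Aux, hx, if_false] at h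
      have := ih (pre ++ [x]) (by simp [List.nodup_append, hpre]; grind) h
      simpa using this

theorem le1Aux_none_of_nodup (pre l : List α) (h : (pre ++ l).Nodup) :
    (le1Aux pre l).2 = none := by
  induction l generalizing pre with
  | nil => simp [le1Aux]
  | cons x l ih =>
    have hx : x ∉ pre := by
      intro hx
      have := (List.nodup_append.1 h).2.2 x hx x (by simp)
      exact this rfl
    simp only [le1Aux, hx, if_false]
    exact ih _ (by simpa using h)

theorem le1Aux_append_of_some (pre l r c : List α) (h : (le1Aux pre l).2 = some c) :
    le1Aux pre (l ++ r) = ((le1Aux pre l).1 ++ r, some c) := by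
  induction l generalizing pre with
  | nil => simp [le1Aux] at h
  | cons x l ih =>
    by_cases hx : x ∈ pre
    · simp only [le1Aux, hx, if_true] at h
      simp [le1Aux, hx, ← h]
    · simp only [le1Aux, hx, if_false] at h
      simp only [List.cons_append, le1Aux, hx, if_false]
      exact ih _ h

theorem length_takeWhile_ne_lt {x : α} {l : List α} (h : x ∈ l) :
    (l.takeWhile (fun y => y ≠ x)).length < l.length := by
  induction l with
  | nil => simp at h
  | cons a l ih =>
    by_cases hax : a = x
    · simp [hax]
    · simp [hax]
      simpa using ih (by grind)

theorem length_le1Aux_of_some (pre l c : List α) (h : (le1Aux pre l).2 = some c) :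
    (le1Aux pre l).1.length < pre.length + l.length := by
  induction l generalizing pre with
  | nil => simp [le1Aux] at h
  | cons x l ih =>
    by_cases hx : x ∈ pre
    · have := length_takeWhile_ne_lt hx
      simp only [le1Aux, hx, if_true, List.length_append, List.length_cons]
      omega
    · simp only [le1Aux, hx, if_false] at h ⊢
      have := ih _ h
      simp at this ⊢
      omega

theorem leAux_of_nodup (n : ℕ) (l : List α) (h : l.Nodup) : leAux n l = (l, 0) := by
  cases n with
  | zero => rfl
  | succ n =>
    have h1 := le1Aux_none_of_nodup [] l (by simpa)
    rw [leAux]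
    split
    · rfl
    · next h2 => rw [h2] at h1; simp at h1

theorem leAux_of_some (n : ℕ) (l c : List α) (h : (le1Aux [] l).2 = some c) :
    leAux (n + 1) l =
      ((leAux n (le1Aux [] l).1).1, c ::ₘ (leAux n (le1Aux [] l).1).2) := by
  rw [leAux]
  split
  · next h2 => rw [h2] at h; simp at h
  · next h2 => rw [h2] at h; simp at h; simp [h2, h]

/-- One step of the loop erasure process: the state after adding the vertex `y` to the
self-avoiding state `s`, together with the loop that is closed, if any. -/
def addVertex (s : List α) (y : α) : List α × Multiset (List α) :=
  if y ∈ s then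
    (s.takeWhile (fun x => x ≠ y) ++ [y], {s.dropWhile (fun x => x ≠ y) ++ [y]})
  else (s ++ [y], 0)

theorem takeWhile_dropWhile_ne (A B : List α) (y : α) (hy : y ∉ A) :
    (A ++ y :: B).takeWhile (fun x => x ≠ y) = A ∧
      (A ++ y :: B).dropWhile (fun x => x ≠ y) = y :: B := by
  induction A with
  | nil => simp
  | cons a A ih =>
    have h1 : a ≠ y := by grind
    have h2 := ih (by grind)
    simpa [h1] using h2

theorem addVertex_of_mem (A B : List α) (y : α) (hy : y ∉ A) :
    addVertex (A ++ y :: B) y = (A ++ [y], {y :: B ++ [y]}) := by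
  have h := takeWhile_dropWhile_ne A B y hy
  rw [addVertex, if_pos (by simp), h.1, h.2]

theorem addVertex_of_not_mem (s : List α) (y : α) (hy : y ∉ s) :
    addVertex s y = (s ++ [y], 0) := by
  rw [addVertex, if_neg hy]

theorem addVertex_nodup (s : List α) (y : α) (hs : s.Nodup) : (addVertex s y).1.Nodup := by
  by_cases hy : y ∈ s
  · obtain ⟨A, B, rfl, hA⟩ := List.eq_append_cons_of_mem hy
    rw [addVertex_of_mem A B y hA]
    simp only [List.nodup_append] at hs ⊢
    grind
  · rw [addVertex_of_not_mem s y hy]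
    simp only [List.nodup_append]
    grind

theorem leAux_append_singleton (k : ℕ) : ∀ (l : List α) (y : α) (n m : ℕ), l.length ≤ k →
    l.length ≤ n → l.length + 1 ≤ m →
    leAux m (l ++ [y]) = ((addVertex (leAux n l).1 y).1,
      (leAux n l).2 + (addVertex (leAux n l).1 y).2) := by
  induction k with
  | zero =>
    intro l y n m hk hn hm
    have hl : l = [] := by simpa using hk
    subst hl
    rw [leAux_of_nodup _ _ (by simp), leAux_of_nodup _ _ (by simp)]
    simp [addVertex]
  | succ k ih =>
    intro l y n m hk hn hm
    obtain ⟨m, rfl⟩ : ∃ m', m = m' + 1 := ⟨m - 1, by omega⟩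
    cases hc : (le1Aux [] l).2 with
    | none =>
      have hl : l.Nodup := by simpa using nodup_of_le1Aux_none [] l (by simp) hc
      rw [leAux_of_nodup n l hl]
      by_cases hy : y ∈ l
      · obtain ⟨A, B, rfl, hA⟩ := List.eq_append_cons_of_mem hy
        have h1 := le1Aux_append_of_none [] _ [y] hc
        have h2 := takeWhile_dropWhile_ne A B y hA
        rw [List.nil_append, le1Aux, if_pos hy, h2.1, h2.2] at h1
        rw [leAux_of_some m _ _ (by rw [h1]), h1, addVertex_of_mem A B y hA]
        have h3 : (A ++ [y]).Nodup := by
          have := addVertex_nodup _ y hl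
          rwa [addVertex_of_mem A B y hA] at this
        simp [leAux_of_nodup m _ h3]
      · rw [addVertex_of_not_mem l y hy]
        have : (l ++ [y]).Nodup := by
          have := addVertex_nodup _ y hl
          rwa [addVertex_of_not_mem l y hy] at this
        simp [leAux_of_nodup _ _ this]
    | some c =>
      have h1 := le1Aux_append_of_some [] l [y] c hc
      have h2 := length_le1Aux_of_some [] l c hc
      simp only [List.length_nil, zero_add] at h2
      obtain ⟨n, rfl⟩ : ∃ n', n = n' + 1 := ⟨n - 1, by omega⟩
      rw [leAux_of_some m _ c (by rw [h1]), leAux_of_some n l c hc, h1]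
      simp only
      rw [ih (le1Aux [] l).1 y n m (by omega) (by omega) (by omega)]
      simp

theorem LE_append_singleton (l : List α) (y : α) :
    LE (l ++ [y]) = (addVertex (LE l) y).1 := by
  rw [LE, leAux_append_singleton l.length l y l.length _ le_rfl le_rfl (by simp)]
  rfl

theorem erasedLoops_append_singleton (l : List α) (y : α) :
    erasedLoops (l ++ [y]) = erasedLoops l + (addVertex (LE l) y).2 := by
  rw [erasedLoops, leAux_append_singleton l.length l y l.length _ le_rfl le_rfl (by simp)]
  rfl

@[simp] theorem LE_nil : LE ([] : List α) = [] := rfl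

@[simp] theorem erasedLoops_nil : erasedLoops ([] : List α) = 0 := rfl

theorem LE_nodup (l : List α) : (LE l).Nodup := by
  induction l using List.reverseRecOn with
  | nil => simp
  | append_singleton l y ih =>
    rw [LE_append_singleton]
    exact addVertex_nodup _ _ ih

theorem mem_of_mem_LE {l : List α} {x : α} (h : x ∈ LE l) : x ∈ l := by
  induction l using List.reverseRecOn with
  | nil => simp at h
  | append_singleton l y ih =>
    rw [LE_append_singleton] at h
    by_cases hy : y ∈ LE l
    · obtain ⟨A, B, hs, hA⟩ := List.eq_append_cons_of_mem hy
      rw [hs] at ih h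
      rw [addVertex_of_mem A B y hA] at h
      simp at h ih ⊢
      grind
    · rw [addVertex_of_not_mem _ y hy] at h
      simp at h ⊢
      grind

theorem getLast?_LE (l : List α) : (LE l).getLast? = l.getLast? := by
  cases l using List.reverseRecOn with
  | nil => simp
  | append_singleton l y =>
    rw [LE_append_singleton]
    by_cases hy : y ∈ LE l
    · obtain ⟨A, B, hs, hA⟩ := List.eq_append_cons_of_mem hy
      rw [hs, addVertex_of_mem A B y hA]
      simp
    · rw [addVertex_of_not_mem _ y hy]
      simp

theorem head?_LE (l : List α) : (LE l).head? = l.head? := by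
  induction l using List.reverseRecOn with
  | nil => simp
  | append_singleton l y ih =>
    rw [LE_append_singleton]
    by_cases hy : y ∈ LE l
    · obtain ⟨A, B, hs, hA⟩ := List.eq_append_cons_of_mem hy
      rw [hs] at ih ⊢
      rw [addVertex_of_mem A B y hA]
      cases A <;> cases l <;> simp_all
    · rw [addVertex_of_not_mem _ y hy]
      rw [List.head?_append, List.head?_append, ih]

theorem length_LE_le (l : List α) : (LE l).length ≤ l.length := by
  induction l using List.reverseRecOn with
  | nil => simp
  | append_singleton l y ih =>
    rw [LE_append_singleton]
    by_cases hy : y ∈ LE l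
    · obtain ⟨A, B, hs, hA⟩ := List.eq_append_cons_of_mem hy
      rw [hs] at ih ⊢
      rw [addVertex_of_mem A B y hA]
      simp at ih ⊢
      omega
    · rw [addVertex_of_not_mem _ y hy]
      simpa using ih

theorem isChain_LE {r : α → α → Prop} {l : List α} (h : l.IsChain r) : (LE l).IsChain r := by
  induction l using List.reverseRecOn with
  | nil => simp
  | append_singleton l y ih =>
    have hl := ih h.left_of_append
    have hlast := getLast?_LE l
    rw [LE_append_singleton]
    by_cases hy : y ∈ LE l
    · obtain ⟨A, B, hs, hA⟩ := List.eq_append_cons_of_mem hy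
      rw [hs] at hl ⊢
      rw [addVertex_of_mem A B y hA]
      have : (A ++ [y]) ++ B = A ++ y :: B := by simp
      rw [← this] at hl
      exact hl.left_of_append
    · rw [addVertex_of_not_mem _ y hy]
      rw [List.isChain_append] at h ⊢
      rw [hlast]
      exact ⟨hl, h.2⟩

theorem LE_eq_singleton_iff (l : List α) (y : α) :
    LE l = [y] ↔ l.head? = some y ∧ l.getLast? = some y := by
  rw [← head?_LE, ← getLast?_LE]
  constructor
  · intro h
    simp [h]
  · rintro ⟨h1, h2⟩
    have hnd := LE_nodup l
    generalize LE l = s at *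
    cases s with
    | nil => simp at h1
    | cons a s =>
      cases s using List.reverseRecOn with
      | nil => simpa using h1
      | append_singleton s b =>
        simp at h1 h2
        have : a :: (s ++ [b]) = (a :: s) ++ [b] := by simp
        rw [this, List.getLast?_append] at h2
        simp at h2
        grind

end LoopErasure

section Transfer

variable {α : Type*} [DecidableEq α]

/-- The finite set of lists of length `n` with entries in `D`. -/
def listsOf (D : Finset α) : ℕ → Finset (List α)
  | 0 => {[]}
  | n + 1 => (listsOf D n ×ˢ D).image (fun p => p.1 ++ [p.2])

theorem mem_listsOf {D : Finset α} {n : ℕ} {l : List α} :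
    l ∈ listsOf D n ↔ l.length = n ∧ ∀ x ∈ l, x ∈ D := by
  induction n generalizing l with
  | zero => cases l <;> simp [listsOf]
  | succ n ih =>
    cases l using List.reverseRecOn with
    | nil => simp [listsOf]
    | append_singleton l y =>
      simp only [listsOf, Finset.mem_image, Finset.mem_product, ih, Prod.exists,
        List.length_append, List.mem_append]
      constructor
      · rintro ⟨l', y', h, h'⟩
        obtain ⟨rfl, h''⟩ := List.append_inj' h' rfl
        simp at h''
        subst h''
        simp
        grind
      · rintro ⟨h1, h2⟩
        refine ⟨l, y, ?_, rfl⟩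
        simp at h1 h2
        grind

theorem sum_listsOf_succ {M : Type*} [AddCommMonoid M] (D : Finset α) (n : ℕ)
    (f : List α → M) :
    ∑ l ∈ listsOf D (n + 1), f l = ∑ l ∈ listsOf D n, ∑ y ∈ D, f (l ++ [y]) := by
  rw [listsOf, Finset.sum_image, Finset.sum_product]
  rintro ⟨a, b⟩ - ⟨a', b'⟩ - h
  have := List.append_inj' (show a ++ [b] = a' ++ [b'] from h) rfl
  simpa using this

/-- The finite set of lists without repetition with entries in `D`. -/
def nodupLists (D : Finset α) : Finset (List α) :=
  ((Finset.range (D.card + 1)).biUnion (listsOf D)).filter List.Nodup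

theorem mem_nodupLists {D : Finset α} {l : List α} :
    l ∈ nodupLists D ↔ l.Nodup ∧ ∀ x ∈ l, x ∈ D := by
  simp only [nodupLists, Finset.mem_filter, Finset.mem_biUnion, Finset.mem_range, mem_listsOf]
  constructor
  · rintro ⟨⟨n, -, -, h⟩, h'⟩
    exact ⟨h', h⟩
  · rintro ⟨h, h'⟩
    refine ⟨⟨l.length, ?_, rfl, h'⟩, h⟩
    have h1 : l.toFinset ⊆ D := fun x hx => h' x (by simpa using hx)
    have h2 := Finset.card_le_card h1
    rw [List.toFinset_card_of_nodup h] at h2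
    omega

variable (r : α → α → Prop) (lam : List α → ℝ≥0)

/-- The weight of a list: the product of the activities of the erased loops if consecutive
vertices are adjacent, and `0` otherwise. -/
def listWt (l : List α) : ℝ≥0 :=
  if l.IsChain r then ((erasedLoops l).map lam).prod else 0

/-- The weight of the closed walk obtained by returning from the end of `p` to its beginning. -/
def cycWt (p : List α) : ℝ≥0 :=
  if (p ++ p.take 1).IsChain r then lam (p ++ p.take 1) else 0

/-- The total weight of the lists of length `n` in `D` whose loop erasure is `η`. -/
def massLE (D : Finset α) (n : ℕ) (η : List α) : ℝ≥0 :=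
  ∑ l ∈ listsOf D n, if LE l = η then listWt r lam l else 0

theorem massLE_of_length_lt (D : Finset α) (n : ℕ) (η : List α) (h : n < η.length) :
    massLE r lam D n η = 0 := by
  refine Finset.sum_eq_zero fun l hl => if_neg ?_
  rintro rfl
  have := length_LE_le l
  rw [mem_listsOf] at hl
  omega

theorem massLE_of_not_nodup (D : Finset α) (n : ℕ) (η : List α) (h : ¬ η.Nodup) :
    massLE r lam D n η = 0 := by
  refine Finset.sum_eq_zero fun l _ => if_neg ?_
  rintro rfl
  exact h (LE_nodup l)

theorem massLE_nil (D : Finset α) (n : ℕ) :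
    massLE r lam D n [] = if n = 0 then 1 else 0 := by
  cases n with
  | zero => simp [massLE, listsOf, listWt]
  | succ n =>
    simp only [Nat.succ_ne_zero, if_false]
    refine Finset.sum_eq_zero fun l hl => if_neg fun h => ?_
    have h1 := head?_LE l
    rw [mem_listsOf] at hl
    cases l <;> simp_all

theorem isChain_append_singleton_iff {l s : List α} {y : α} (hs : LE l = s) :
    (l ++ [y]).IsChain r ↔ l.IsChain r ∧ ∀ x ∈ s.getLast?, r x y := by
  rw [← hs, getLast?_LE, List.isChain_append]
  simp

theorem listWt_append_singleton_LE (D : Finset α) {A l : List α} {y : α}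
    (hA : (A ++ [y]).Nodup) (hAr : (A ++ [y]).IsChain r) (hl : ∀ x ∈ l, x ∈ D) :
    (if LE (l ++ [y]) = A ++ [y] then listWt r lam (l ++ [y]) else 0) =
      (if LE l = A then listWt r lam l else 0) +
        ∑ p ∈ nodupLists D with p.head? = some y,
          cycWt r lam p * (if LE l = A ++ p then listWt r lam l else 0) := by
  have hyA : y ∉ A := by
    intro h
    exact (List.nodup_append.1 hA).2.2 y h y (by simp) rfl
  by_cases hy : y ∈ LE l
  · obtain ⟨A', B, hs, hA'⟩ := List.eq_append_cons_of_mem hy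
    have h1 : LE l ≠ A := fun h => hyA (h ▸ hy)
    rw [if_neg h1, zero_add, LE_append_singleton, hs, addVertex_of_mem A' B y hA']
    by_cases hAA : A' = A
    · subst hAA
      rw [if_pos rfl, Finset.sum_eq_single (y :: B)]
      · simp only [if_true, cycWt, List.take_succ_cons, List.take_zero, listWt,
          erasedLoops_append_singleton, hs, addVertex_of_mem A' B y hA',
          isChain_append_singleton_iff r hs]
        by_cases hc : l.IsChain r
        · have h3 := isChain_LE hc
          rw [hs] at h3
          have h4 := h3.right_of_append
          have h5 : ((y :: B) ++ [y]).IsChain r ↔ ∀ x ∈ (A' ++ y :: B).getLast?, r x y := by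
            rw [List.isChain_append]
            simp [h4]
          simp only [h5, hc, true_and, if_true]
          split_ifs <;> simp [mul_comm]
        · simp [hc]
      · intro p _ hp
        rw [if_neg, mul_zero]
        intro h
        exact hp (List.append_cancel_left h).symm
      · intro h
        exfalso
        apply h
        have h3 := LE_nodup l
        rw [hs] at h3
        simp only [Finset.mem_filter, mem_nodupLists, List.head?_cons, and_true]
        refine ⟨(List.nodup_append.1 h3).2.1, fun x hx => hl x (mem_of_mem_LE ?_)⟩
        rw [hs]
        exact List.mem_append_right _ hx
    · rw [if_neg (fun h => hAA (List.append_cancel_right h))]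
      symm
      refine Finset.sum_eq_zero fun p hp => ?_
      rw [if_neg, mul_zero]
      intro h
      simp only [Finset.mem_filter] at hp
      apply hAA
      have hp2 : p = y :: p.tail := by
        cases p <;> simp_all
      rw [hp2] at h
      have e1 := (takeWhile_dropWhile_ne A' B y hA').1
      have e2 := (takeWhile_dropWhile_ne A p.tail y hyA).1
      rw [h] at e1
      exact e1.symm.trans e2
  · rw [LE_append_singleton, addVertex_of_not_mem _ y hy, Finset.sum_eq_zero, add_zero]
    · by_cases h1 : LE l = A
      · simp only [h1, if_true, listWt, isChain_append_singleton_iff r h1,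
          erasedLoops_append_singleton]
        rw [addVertex_of_not_mem _ y hyA]
        rw [List.isChain_append] at hAr
        have : ∀ x ∈ A.getLast?, r x y := by simpa using hAr.2.2
        simp only [add_zero]
        refine if_congr ?_ rfl rfl
        tauto
      · rw [if_neg h1, if_neg (fun h => h1 (List.append_cancel_right h))]
    · intro p hp
      rw [if_neg, mul_zero]
      intro h
      apply hy
      rw [h]
      simp only [Finset.mem_filter] at hp
      cases p <;> simp_all

theorem massLE_succ (D : Finset α) (n : ℕ) {A : List α} {y : α} (hy : y ∈ D)
    (hA : (A ++ [y]).Nodup) (hAr : (A ++ [y]).IsChain r) :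
    massLE r lam D (n + 1) (A ++ [y]) = massLE r lam D n A +
      ∑ p ∈ nodupLists D with p.head? = some y, cycWt r lam p * massLE r lam D n (A ++ p) := by
  rw [massLE, sum_listsOf_succ]
  have h1 : ∀ l ∈ listsOf D n, (∑ y' ∈ D, if LE (l ++ [y']) = A ++ [y] then
      listWt r lam (l ++ [y']) else 0) = (if LE l = A then listWt r lam l else 0) +
        ∑ p ∈ nodupLists D with p.head? = some y,
          cycWt r lam p * (if LE l = A ++ p then listWt r lam l else 0) := by
    intro l hl
    rw [mem_listsOf] at hl
    rw [← listWt_append_singleton_LE r lam D hA hAr hl.2, Finset.sum_eq_single y]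
    · intro y' _ hne
      refine if_neg fun h => hne ?_
      have h2 := getLast?_LE (l ++ [y'])
      rw [h] at h2
      simpa using h2.symm
    · exact fun h => absurd hy h
  rw [Finset.sum_congr rfl h1, Finset.sum_add_distrib, Finset.sum_comm]
  simp only [massLE, Finset.mul_sum]

end Transfer

section CycleGas

open PowerSeries

variable {α : Type*} [DecidableEq α]

/-- The families of pairwise disjoint subsets of `D`. -/
def disjFamilies (D : Finset α) : Finset (Finset (Finset α)) :=
  D.powerset.powerset.filter (fun π => ∀ S ∈ π, ∀ T ∈ π, S ≠ T → Disjoint S T)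

theorem mem_disjFamilies {D : Finset α} {π : Finset (Finset α)} :
    π ∈ disjFamilies D ↔ (∀ S ∈ π, S ⊆ D) ∧ ∀ S ∈ π, ∀ T ∈ π, S ≠ T → Disjoint S T := by
  simp [disjFamilies, Finset.subset_iff]

/-- The signed partition function of a gas of disjoint subsets of `D` with activities `u`. -/
def gas {R : Type*} [CommRing R] (u : Finset α → R) (D : Finset α) : R :=
  ∑ π ∈ disjFamilies D, ∏ S ∈ π, (-(u S))

theorem filter_disjFamilies (D : Finset α) (x : α) :
    (disjFamilies D).filter (fun π => ¬ ∃ S ∈ π, x ∈ S) = disjFamilies (D.erase x) := by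
  ext π
  simp only [Finset.mem_filter, mem_disjFamilies, Finset.subset_erase]
  push Not
  constructor
  · rintro ⟨⟨h1, h2⟩, h3⟩
    exact ⟨fun S hS => ⟨h1 S hS, h3 S hS⟩, h2⟩
  · rintro ⟨h1, h2⟩
    exact ⟨⟨fun S hS => (h1 S hS).1, h2⟩, fun S hS => (h1 S hS).2⟩

theorem sum_filter_disjFamilies {R : Type*} [CommRing R] (u : Finset α → R) (D : Finset α)
    (x : α) :
    ∑ π ∈ disjFamilies D with ∃ S ∈ π, x ∈ S, ∏ S ∈ π, (-(u S)) =
      ∑ S ∈ D.powerset with x ∈ S, -(u S) * gas u (D \ S) := by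
  symm
  simp only [gas, Finset.mul_sum]
  rw [Finset.sum_sigma']
  refine Finset.sum_bij (fun p _ => insert p.1 p.2) ?_ ?_ ?_ ?_
  · rintro ⟨S, π⟩ h
    simp only [Finset.mem_sigma, Finset.mem_filter, Finset.mem_powerset, mem_disjFamilies] at h ⊢
    obtain ⟨⟨h1, h2⟩, h3, h4⟩ := h
    refine ⟨⟨?_, ?_⟩, S, by simp, h2⟩
    · intro T hT
      rcases Finset.mem_insert.1 hT with rfl | hT
      · exact h1
      · exact (h3 T hT).trans Finset.sdiff_subset
    · have h5 : ∀ T ∈ π, Disjoint S T := fun T hT =>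
        Finset.disjoint_of_subset_right (h3 T hT) Finset.disjoint_sdiff
      intro T hT T' hT' hne
      rcases Finset.mem_insert.1 hT with rfl | hTπ
      · rcases Finset.mem_insert.1 hT' with rfl | hTπ'
        · exact absurd rfl hne
        · exact h5 _ hTπ'
      · rcases Finset.mem_insert.1 hT' with rfl | hTπ'
        · exact (h5 _ hTπ).symm
        · exact h4 _ hTπ _ hTπ' hne
  · have key : ∀ S π, S ∈ D.powerset.filter (x ∈ ·) → π ∈ disjFamilies (D \ S) →
        (insert S π).filter (x ∈ ·) = {S} ∧ (insert S π).filter (x ∉ ·) = π := by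
      intro S π hS hπ
      simp only [Finset.mem_filter, mem_disjFamilies] at hS hπ
      have h1 : ∀ T ∈ π, x ∉ T := fun T hT hx =>
        (Finset.mem_sdiff.1 (hπ.1 T hT hx)).2 hS.2
      constructor
      · ext T
        simp only [Finset.mem_filter, Finset.mem_insert, Finset.mem_singleton]
        grind
      · ext T
        simp only [Finset.mem_filter, Finset.mem_insert]
        grind
    rintro ⟨S, π⟩ h ⟨S', π'⟩ h' heq
    simp only [Finset.mem_sigma] at h h' heq
    have h1 := key S π h.1 h.2
    have h2 := key S' π' h'.1 h'.2
    rw [heq] at h1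
    have h3 : S = S' := by simpa using h1.1.symm.trans h2.1
    have h4 : π = π' := h1.2.symm.trans h2.2
    subst h3 h4
    rfl
  · intro π hπ
    simp only [Finset.mem_filter, mem_disjFamilies] at hπ
    obtain ⟨⟨h1, h2⟩, S, hS, hxS⟩ := hπ
    refine ⟨⟨S, π.erase S⟩, ?_, Finset.insert_erase hS⟩
    simp only [Finset.mem_sigma, Finset.mem_filter, Finset.mem_powerset, mem_disjFamilies]
    refine ⟨⟨h1 S hS, hxS⟩, ?_, ?_⟩
    · intro T hT
      rw [Finset.mem_erase] at hT
      rw [Finset.subset_sdiff]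
      exact ⟨h1 T hT.2, h2 T hT.2 S hS hT.1⟩
    · intro T hT T' hT'
      exact h2 T (Finset.mem_of_mem_erase hT) T' (Finset.mem_of_mem_erase hT')
  · rintro ⟨S, π⟩ h
    simp only [Finset.mem_sigma, Finset.mem_filter, mem_disjFamilies] at h
    rw [Finset.prod_insert]
    intro hS
    exact (Finset.mem_sdiff.1 (h.2.1 S hS h.1.2)).2 h.1.2

theorem gas_sub_gas_erase {R : Type*} [CommRing R] (u : Finset α → R) (D : Finset α) (x : α) :
    gas u D - gas u (D.erase x) =
      ∑ π ∈ disjFamilies D with ∃ S ∈ π, x ∈ S, ∏ S ∈ π, (-(u S)) := by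
  rw [gas, gas, ← filter_disjFamilies D x, sub_eq_iff_eq_add,
    Finset.sum_filter_add_sum_filter_not]

theorem gas_erase {R : Type*} [CommRing R] (u : Finset α → R) (D : Finset α) (x : α) :
    gas u (D.erase x) = gas u D + ∑ S ∈ D.powerset with x ∈ S, u S * gas u (D \ S) := by
  have h1 := gas_sub_gas_erase u D x
  rw [sum_filter_disjFamilies] at h1
  simp only [neg_mul, Finset.sum_neg_distrib] at h1
  linear_combination -h1

theorem X_mul_derivative_prod (a : Finset α → ℝ) (π : Finset (Finset α)) :
    X * d⁄dX ℝ (∏ S ∈ π, (-(C (a S) * X ^ S.card : ℝ⟦X⟧))) =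
      ((∑ S ∈ π, S.card : ℕ) : ℝ⟦X⟧) * ∏ S ∈ π, (-(C (a S) * X ^ S.card)) := by
  induction π using Finset.induction_on with
  | empty => simp
  | insert S π hS ih =>
    rw [Finset.prod_insert hS, Finset.sum_insert hS, Derivation.leibniz, smul_eq_mul, smul_eq_mul]
    have h1 : X * d⁄dX ℝ (-(C (a S) * X ^ S.card : ℝ⟦X⟧)) =
        (S.card : ℝ⟦X⟧) * (-(C (a S) * X ^ S.card)) := by
      rw [map_neg, Derivation.leibniz, derivative_C, Derivation.leibniz_pow, derivative_X]
      cases S.card with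
      | zero => simp
      | succ k =>
        simp only [smul_eq_mul, nsmul_eq_mul, Nat.add_sub_cancel]
        ring
    push_cast at ih ⊢
    linear_combination (-(C (a S) * X ^ S.card : ℝ⟦X⟧)) * ih +
      (∏ S ∈ π, (-(C (a S) * X ^ S.card : ℝ⟦X⟧))) * h1

theorem X_mul_derivative_gas (a : Finset α → ℝ) (D : Finset α) :
    X * d⁄dX ℝ (gas (fun S => (C (a S) * X ^ S.card : ℝ⟦X⟧)) D) =
      ∑ y ∈ D, (gas (fun S => (C (a S) * X ^ S.card : ℝ⟦X⟧)) D -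
        gas (fun S => (C (a S) * X ^ S.card : ℝ⟦X⟧)) (D.erase y)) := by
  simp only [gas_sub_gas_erase, Finset.sum_filter]
  rw [Finset.sum_comm, gas, map_sum, Finset.mul_sum]
  refine Finset.sum_congr rfl fun π hπ => ?_
  rw [X_mul_derivative_prod, ← Finset.sum_filter, Finset.sum_const, nsmul_eq_mul]
  congr 2
  rw [mem_disjFamilies] at hπ
  have h1 := Finset.card_biUnion (s := π) (t := id) (fun S hS T hT h => hπ.2 S hS T hT h)
  simp only [id] at h1
  rw [← h1]
  congr 1
  ext y
  simp only [Finset.mem_biUnion, Finset.mem_filter, id]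
  constructor
  · rintro ⟨S, hS, hy⟩
    exact ⟨hπ.1 S hS hy, S, hS, hy⟩
  · exact fun h => h.2

theorem constantCoeff_gas (a : Finset α → ℝ) (ha : a ∅ = 0) (D : Finset α) :
    constantCoeff (gas (fun S => (C (a S) * X ^ S.card : ℝ⟦X⟧)) D) = 1 := by
  induction D using Finset.induction_on with
  | empty =>
    have : disjFamilies (∅ : Finset α) = {∅, {∅}} := by
      ext π
      simp only [mem_disjFamilies, Finset.subset_empty, Finset.mem_insert, Finset.mem_singleton]
      constructor
      · rintro ⟨h, -⟩
        rw [← Finset.subset_singleton_iff]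
        intro S hS
        simp [h S hS]
      · rintro (rfl | rfl) <;> simp
    rw [gas, this, Finset.sum_pair (by simp)]
    simp [ha]
  | insert x D hx ih =>
    have h := gas_erase (fun S => (C (a S) * X ^ S.card : ℝ⟦X⟧)) (insert x D) x
    rw [Finset.erase_insert hx] at h
    rw [h, map_add, map_sum, Finset.sum_eq_zero, add_zero] at ih
    · exact ih
    · intro S hS
      have : S.card ≠ 0 := by
        rw [Finset.card_ne_zero]
        exact ⟨x, (Finset.mem_filter.1 hS).2⟩
      simp [this]

end CycleGas

section Partition

open PowerSeries

variable {α : Type*} [DecidableEq α] (r : α → α → Prop) (lam : List α → ℝ≥0)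

theorem rotate_idxOf_rotate {p : List α} {x : α} (hp : p.Nodup) (hx : p.head? = some x) (k : ℕ) :
    (p.rotate k).rotate ((p.rotate k).idxOf x) = p := by
  have hxp : x ∈ p := List.mem_of_head? hx
  have hlt : (p.rotate k).idxOf x < (p.rotate k).length :=
    List.idxOf_lt_length_of_mem (List.mem_rotate.2 hxp)
  have h1 := List.head?_rotate hlt
  rw [List.getElem?_idxOf (List.mem_rotate.2 hxp), List.rotate_rotate] at h1
  rw [List.rotate_rotate]
  have hpos : 0 < p.length := List.length_pos_of_mem hxp
  rw [← List.rotate_mod] at h1 ⊢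
  have hm := Nat.mod_lt (k + (p.rotate k).idxOf x) hpos
  rw [List.head?_rotate hm] at h1
  rw [List.head?_eq_getElem?, ← h1] at hx
  have := (List.getElem?_inj hpos hp).1 hx
  rw [← this, List.rotate_zero]

/-- The total weight of the cycles with vertex set `S` started at `x`. -/
def rootedCycleWt (x : α) (S : Finset α) : ℝ≥0 :=
  ∑ p ∈ nodupLists S with p.head? = some x ∧ p.toFinset = S, cycWt r lam p

/-- The total weight of the cycles with vertex set `S`, up to the choice of the root. -/
def cycleWt (S : Finset α) : ℝ≥0 :=
  if h : S.Nonempty then rootedCycleWt r lam h.choose S else 0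

variable {r lam}

theorem rootedCycleWt_eq (hrot : ∀ p k, List.Nodup p → cycWt r lam (p.rotate k) = cycWt r lam p)
    {S : Finset α} {x y : α} (hx : x ∈ S) (hy : y ∈ S) :
    rootedCycleWt r lam x S = rootedCycleWt r lam y S := by
  have key : ∀ z ∈ S, ∀ w ∈ S, ∀ p ∈ (nodupLists S).filter
      (fun p => p.head? = some z ∧ p.toFinset = S),
      p.rotate (p.idxOf w) ∈ (nodupLists S).filter
        (fun p => p.head? = some w ∧ p.toFinset = S) := by
    intro z hz w hw p hp
    simp only [Finset.mem_filter, mem_nodupLists, List.nodup_rotate, List.mem_rotate] at hp ⊢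
    have hwp : w ∈ p := by
      rw [← hp.2.2] at hw
      simpa using hw
    refine ⟨hp.1, ?_, ?_⟩
    · rw [List.head?_rotate (List.idxOf_lt_length_of_mem hwp), List.getElem?_idxOf hwp]
    · rw [← hp.2.2]
      ext v
      simp
  refine Finset.sum_bij' (fun p _ => p.rotate (p.idxOf y)) (fun p _ => p.rotate (p.idxOf x))
    (key x hx y hy) (key y hy x hx) ?_ ?_ ?_
  · intro p hp
    simp only [Finset.mem_filter, mem_nodupLists] at hp
    exact rotate_idxOf_rotate hp.1.1 hp.2.1 _
  · intro p hp
    simp only [Finset.mem_filter, mem_nodupLists] at hp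
    exact rotate_idxOf_rotate hp.1.1 hp.2.1 _
  · intro p hp
    simp only [Finset.mem_filter, mem_nodupLists] at hp
    exact (hrot p _ hp.1.1).symm

theorem cycleWt_eq (hrot : ∀ p k, List.Nodup p → cycWt r lam (p.rotate k) = cycWt r lam p)
    {S : Finset α} {x : α} (hx : x ∈ S) : cycleWt r lam S = rootedCycleWt r lam x S := by
  have h : S.Nonempty := ⟨x, hx⟩
  rw [cycleWt, dif_pos h]
  exact rootedCycleWt_eq hrot h.choose_spec hx

variable (r lam)

/-- The partition function of the gas of disjoint cycles in `D`, as a power series in the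
total number of vertices. -/
def cycleGas (D : Finset α) : ℝ⟦X⟧ :=
  gas (fun S => (C (cycleWt r lam S : ℝ) * X ^ S.card : ℝ⟦X⟧)) D

theorem constantCoeff_cycleGas (D : Finset α) : constantCoeff (cycleGas r lam D) = 1 :=
  constantCoeff_gas _ (by simp [cycleWt]) D

theorem cycleGas_ne_zero (D : Finset α) : cycleGas r lam D ≠ 0 := by
  intro h
  have := constantCoeff_cycleGas r lam D
  simp [h] at this

theorem X_mul_derivative_cycleGas (D : Finset α) :
    X * d⁄dX ℝ (cycleGas r lam D) =
      ∑ y ∈ D, (cycleGas r lam D - cycleGas r lam (D.erase y)) :=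
  X_mul_derivative_gas _ D

variable {r lam}

theorem cycleGas_erase
    (hrot : ∀ p k, List.Nodup p → cycWt r lam (p.rotate k) = cycWt r lam p)
    (D : Finset α) (y : α) :
    cycleGas r lam (D.erase y) = cycleGas r lam D +
      ∑ p ∈ nodupLists D with p.head? = some y,
        C (cycWt r lam p : ℝ) * X ^ p.length * cycleGas r lam (D \ p.toFinset) := by
  rw [cycleGas, gas_erase, ← cycleGas]
  congr 1
  rw [← Finset.sum_fiberwise_of_maps_to (g := List.toFinset)
    (t := D.powerset.filter (y ∈ ·))]
  · refine Finset.sum_congr rfl fun S hS => ?_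
    rw [Finset.mem_filter, Finset.mem_powerset] at hS
    rw [cycleWt_eq hrot hS.2, rootedCycleWt]
    have h1 : ((nodupLists D).filter (fun p => p.head? = some y)).filter
        (fun p => p.toFinset = S) = (nodupLists S).filter
        (fun p => p.head? = some y ∧ p.toFinset = S) := by
      ext p
      simp only [Finset.mem_filter, mem_nodupLists]
      constructor
      · rintro ⟨⟨⟨h1, h2⟩, h3⟩, h4⟩
        refine ⟨⟨h1, fun x hx => ?_⟩, h3, h4⟩
        rw [← h4]
        simpa using hx
      · rintro ⟨⟨h1, h2⟩, h3, h4⟩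
        exact ⟨⟨⟨h1, fun x hx => hS.1 (h2 x hx)⟩, h3⟩, h4⟩
    rw [h1]
    push_cast
    rw [map_sum, Finset.sum_mul, Finset.sum_mul]
    refine Finset.sum_congr rfl fun p hp => ?_
    simp only [Finset.mem_filter, mem_nodupLists] at hp
    rw [← hp.2.2, List.toFinset_card_of_nodup hp.1.1]
    rfl
  · intro p hp
    simp only [Finset.mem_filter, mem_nodupLists, Finset.mem_powerset] at hp ⊢
    exact ⟨fun x hx => hp.1.2 x (by simpa using hx), by
      simpa using List.mem_of_head? hp.2⟩

theorem cycleGas_sdiff_concat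
    (hrot : ∀ p k, List.Nodup p → cycWt r lam (p.rotate k) = cycWt r lam p)
    (D : Finset α) {A : List α} {y : α} (hA : (A ++ [y]).Nodup) :
    cycleGas r lam (D \ (A ++ [y]).toFinset) = cycleGas r lam (D \ A.toFinset) +
      ∑ p ∈ nodupLists D with p.head? = some y ∧ (A ++ p).Nodup,
        C (cycWt r lam p : ℝ) * X ^ p.length * cycleGas r lam (D \ (A ++ p).toFinset) := by
  have h1 : D \ (A ++ [y]).toFinset = (D \ A.toFinset).erase y := by
    ext x
    simp
    tauto
  rw [h1, cycleGas_erase hrot, add_right_inj]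
  have h2 : (nodupLists (D \ A.toFinset)).filter (fun p => p.head? = some y) =
      (nodupLists D).filter (fun p => p.head? = some y ∧ (A ++ p).Nodup) := by
    ext p
    simp only [Finset.mem_filter, mem_nodupLists, List.nodup_append] at hA ⊢
    simp only [Finset.mem_sdiff, List.mem_toFinset]
    grind
  rw [h2]
  refine Finset.sum_congr rfl fun p _ => ?_
  rw [List.toFinset_append, sdiff_sdiff_left, Finset.sup_eq_union]

variable (r lam)

/-- The generating function of the walks in `D` with loop erasure `η`. -/
def seriesLE (D : Finset α) (η : List α) : ℝ⟦X⟧ :=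
  PowerSeries.mk fun n => (massLE r lam D (n + η.length) η : ℝ)

theorem seriesLE_nil (D : Finset α) : seriesLE r lam D [] = 1 := by
  ext n
  rw [seriesLE, coeff_mk, List.length_nil, add_zero, massLE_nil, coeff_one]
  split_ifs <;> simp

theorem seriesLE_concat (D : Finset α) {A : List α} {y : α} (hy : y ∈ D)
    (hA : (A ++ [y]).Nodup) (hAr : (A ++ [y]).IsChain r) :
    seriesLE r lam D (A ++ [y]) = seriesLE r lam D A +
      ∑ p ∈ nodupLists D with p.head? = some y ∧ (A ++ p).Nodup,
        C (cycWt r lam p : ℝ) * X ^ p.length * seriesLE r lam D (A ++ p) := by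
  ext n
  rw [map_add, map_sum]
  simp only [seriesLE, coeff_mk, mul_assoc, coeff_C_mul, coeff_X_pow_mul']
  rw [List.length_append, List.length_singleton, ← add_assoc, massLE_succ r lam D _ hy hA hAr]
  push_cast
  congr 1
  rw [← Finset.filter_filter, Finset.sum_filter (fun p => (A ++ p).Nodup)]
  refine Finset.sum_congr rfl fun p _ => ?_
  by_cases hp : (A ++ p).Nodup
  · rw [if_pos hp]
    by_cases hn : p.length ≤ n
    · rw [if_pos hn]
      have h1 : n - p.length + (A ++ p).length = n + A.length := by
        rw [List.length_append]
        omega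
      rw [h1]
    · rw [if_neg hn, massLE_of_length_lt]
      · simp
      · rw [List.length_append]
        omega
  · rw [if_neg hp, massLE_of_not_nodup _ _ _ _ _ hp]
    simp

variable {r lam}

theorem coeff_seriesLE_mul_cycleGas_sub
    (hrot : ∀ p k, List.Nodup p → cycWt r lam (p.rotate k) = cycWt r lam p) (D : Finset α)
    (k : ℕ) : ∀ (n : ℕ) (η : List α), n + η.length ≤ k → η.Nodup → η.IsChain r →
      (∀ x ∈ η, x ∈ D) →
      coeff n (seriesLE r lam D η * cycleGas r lam D - cycleGas r lam (D \ η.toFinset)) = 0 := by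
  induction k with
  | zero =>
    intro n η h _ _ _
    obtain rfl : η = [] := by
      rw [← List.length_eq_zero_iff]
      omega
    simp [seriesLE_nil]
  | succ k ih =>
    intro n η h hη hr hD
    cases η using List.reverseRecOn with
    | nil => simp [seriesLE_nil]
    | append_singleton A y =>
      rw [seriesLE_concat r lam D (hD y (by simp)) hη hr, cycleGas_sdiff_concat hrot D hη]
      have h1 : ∀ a b c e f : ℝ⟦X⟧, (a + b) * c - (e + f) = (a * c - e) + (b * c - f) := by
        intros; ring
      rw [h1, map_add, Finset.sum_mul, ← Finset.sum_sub_distrib, map_sum]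
      rw [List.length_append, List.length_singleton] at h
      rw [ih n A (by omega) (List.nodup_append.1 hη).1 hr.left_of_append
        (fun x hx => hD x (by simp [hx])), zero_add]
      refine Finset.sum_eq_zero fun p hp => ?_
      rw [mul_assoc, ← mul_sub, mul_assoc, coeff_C_mul, coeff_X_pow_mul']
      simp only [Finset.mem_filter, mem_nodupLists] at hp
      by_cases hn : p.length ≤ n
      · rw [if_pos hn]
        by_cases hc : (p ++ p.take 1).IsChain r
        · obtain ⟨B, rfl⟩ : ∃ B, p = y :: B := by
            cases p <;> simp_all
          rw [ih _ _ _ hp.2.2 _ _, mul_zero]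
          · simp only [List.length_append, List.length_cons] at hn ⊢
            omega
          · have := hr.append_overlap (l₃ := B) (by simpa using hc.left_of_append) (by simp)
            simpa using this
          · intro x hx
            rcases List.mem_append.1 hx with hx | hx
            · exact hD x (by simp [hx])
            · exact hp.1.2 x hx
        · simp [cycWt, hc]
      · rw [if_neg hn, mul_zero]

theorem seriesLE_mul_cycleGas
    (hrot : ∀ p k, List.Nodup p → cycWt r lam (p.rotate k) = cycWt r lam p) (D : Finset α)
    {η : List α} (hη : η.Nodup) (hr : η.IsChain r) (hD : ∀ x ∈ η, x ∈ D) :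
    seriesLE r lam D η * cycleGas r lam D = cycleGas r lam (D \ η.toFinset) := by
  rw [← sub_eq_zero]
  ext n
  exact coeff_seriesLE_mul_cycleGas_sub hrot D _ n η le_rfl hη hr hD

theorem constantCoeff_seriesLE
    (hrot : ∀ p k, List.Nodup p → cycWt r lam (p.rotate k) = cycWt r lam p) (D : Finset α)
    {η : List α} (hη : η.Nodup) (hr : η.IsChain r) (hD : ∀ x ∈ η, x ∈ D) :
    constantCoeff (seriesLE r lam D η) = 1 := by
  have h := congrArg constantCoeff (seriesLE_mul_cycleGas hrot D hη hr hD)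
  rwa [map_mul, constantCoeff_cycleGas, constantCoeff_cycleGas, mul_one] at h

theorem X_mul_derivative_cycleGas_eq
    (hrot : ∀ p k, List.Nodup p → cycWt r lam (p.rotate k) = cycWt r lam p) (D : Finset α) :
    X * d⁄dX ℝ (cycleGas r lam D) =
      -(cycleGas r lam D * ∑ y ∈ D, (seriesLE r lam D [y] - 1)) := by
  rw [X_mul_derivative_cycleGas, Finset.mul_sum, ← Finset.sum_neg_distrib]
  refine Finset.sum_congr rfl fun y hy => ?_
  have h := seriesLE_mul_cycleGas hrot D (η := [y]) (by simp) (by simp) (by simpa)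
  have h1 : D \ [y].toFinset = D.erase y := by
    ext x
    simp
    tauto
  rw [h1] at h
  rw [← h]
  ring

/-- The generating function of the closed walks in `D` that visit `η` is the logarithmic
derivative of the generating function of walks with loop erasure `η`. -/
theorem X_mul_derivative_seriesLE
    (hrot : ∀ p k, List.Nodup p → cycWt r lam (p.rotate k) = cycWt r lam p) (D : Finset α)
    {η : List α} (hη : η.Nodup) (hr : η.IsChain r) (hD : ∀ x ∈ η, x ∈ D) :
    X * d⁄dX ℝ (seriesLE r lam D η) = seriesLE r lam D η *
      (∑ y ∈ D, (seriesLE r lam D [y] - 1) -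
        ∑ y ∈ D \ η.toFinset, (seriesLE r lam (D \ η.toFinset) [y] - 1)) := by
  have h := seriesLE_mul_cycleGas hrot D hη hr hD
  have h1 := X_mul_derivative_cycleGas_eq hrot D
  have h2 := X_mul_derivative_cycleGas_eq hrot (D \ η.toFinset)
  rw [← h, Derivation.leibniz, smul_eq_mul, smul_eq_mul] at h2
  apply mul_right_cancel₀ (cycleGas_ne_zero r lam D)
  linear_combination h2 - seriesLE r lam D η * h1

end Partition

section Exponential

open PowerSeries

/-- The value in `[0,∞]` of a power series with nonnegative coefficients. -/
def evalSeries (z : ℝ≥0) (F : ℝ≥0⟦X⟧) : ℝ≥0∞ :=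
  ∑' n, ((coeff n F : ℝ≥0) : ℝ≥0∞) * (z : ℝ≥0∞) ^ n

theorem evalSeries_one (z : ℝ≥0) : evalSeries z 1 = 1 := by
  rw [evalSeries, tsum_eq_single 0]
  · simp
  · intro n hn
    simp [coeff_one, hn]

theorem evalSeries_mul (z : ℝ≥0) (F G : ℝ≥0⟦X⟧) :
    evalSeries z (F * G) = evalSeries z F * evalSeries z G := by
  simp only [evalSeries]
  rw [← ENNReal.tsum_mul_right]
  simp only [← ENNReal.tsum_mul_left]
  rw [← ENNReal.tsum_prod, ← Finset.HasAntidiagonal.sigmaAntidiagonalEquivProd.tsum_eq,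
    ENNReal.tsum_sigma']
  refine tsum_congr fun n => ?_
  rw [tsum_fintype, coeff_mul]
  push_cast
  rw [Finset.sum_mul, ← Finset.sum_coe_sort]
  refine Finset.sum_congr rfl fun p _ => ?_
  have hz : (z : ℝ≥0∞) ^ n = (z : ℝ≥0∞) ^ p.1.1 * (z : ℝ≥0∞) ^ p.1.2 := by
    rw [← pow_add, Finset.HasAntidiagonal.mem_antidiagonal.1 p.2]
  simp only [Finset.HasAntidiagonal.sigmaAntidiagonalEquivProd_apply]
  rw [hz]
  ring

theorem evalSeries_pow (z : ℝ≥0) (F : ℝ≥0⟦X⟧) (k : ℕ) :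
    evalSeries z (F ^ k) = evalSeries z F ^ k := by
  induction k with
  | zero => simp [evalSeries_one]
  | succ k ih => rw [pow_succ, evalSeries_mul, ih, pow_succ]

theorem eexp_eq_tsum (x : ℝ≥0∞) : eexp x = ∑' k : ℕ, ((k.factorial : ℝ≥0)⁻¹ : ℝ≥0) * x ^ k := by
  by_cases hx : x = ⊤
  · subst hx
    rw [eexp, if_pos rfl]
    symm
    rw [eq_top_iff]
    refine le_trans ?_ (ENNReal.le_tsum 1)
    simp
  · rw [eexp, if_neg hx]
    lift x to ℝ≥0 using hx
    rw [Real.exp_eq_exp_ℝ, NormedSpace.exp_eq_tsum_div, ENNReal.ofReal_tsum_of_nonneg]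
    · refine tsum_congr fun k => ?_
      rw [ENNReal.coe_toReal]
      have : ((x : ℝ) ^ k / (k.factorial : ℝ)) = (((k.factorial : ℝ≥0)⁻¹ * x ^ k : ℝ≥0) : ℝ) := by
        push_cast
        ring
      rw [this, ENNReal.ofReal_coe_nnreal]
      push_cast
      rfl
    · intro n
      positivity
    · exact NormedSpace.expSeries_div_summable _

/-- The truncated exponential of a power series. -/
def truncExp (f : ℝ≥0⟦X⟧) (N : ℕ) : ℝ≥0⟦X⟧ :=
  ∑ k ∈ Finset.range (N + 1), C ((k.factorial : ℝ≥0)⁻¹) * f ^ k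

theorem X_mul_derivative_truncExp (f : ℝ≥0⟦X⟧) (N : ℕ) :
    X * d⁄dX ℝ≥0 (truncExp f (N + 1)) = truncExp f N * (X * d⁄dX ℝ≥0 f) := by
  rw [truncExp, Finset.sum_range_succ', map_add, map_sum, truncExp, Finset.sum_mul, mul_add,
    Finset.mul_sum]
  have h0 : d⁄dX ℝ≥0 (C (((0 : ℕ).factorial : ℝ≥0)⁻¹) * f ^ 0) = 0 := by simp
  rw [h0, mul_zero, add_zero]
  refine Finset.sum_congr rfl fun k _ => ?_
  rw [Derivation.leibniz, derivative_C, Derivation.leibniz_pow]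
  simp only [smul_eq_mul, nsmul_eq_mul, Nat.add_sub_cancel]
  have h1 : C (((k + 1).factorial : ℝ≥0)⁻¹) * ((k + 1 : ℕ) : ℝ≥0⟦X⟧) =
      C ((k.factorial : ℝ≥0)⁻¹) := by
    rw [← map_natCast (C (R := ℝ≥0)), ← map_mul]
    congr 1
    rw [Nat.factorial_succ]
    push_cast
    have : (k.factorial : ℝ≥0) ≠ 0 := by positivity
    have : (k : ℝ≥0) + 1 ≠ 0 := by positivity
    field_simp
  rw [← h1]
  ring

theorem coeff_pow_of_lt {f : ℝ≥0⟦X⟧} (hf : constantCoeff f = 0) {n k : ℕ} (h : n < k) :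
    coeff n (f ^ k) = 0 :=
  X_pow_dvd_iff.1 (pow_dvd_pow_of_dvd (X_dvd_iff.2 hf) k) n h

theorem coeff_truncExp {f : ℝ≥0⟦X⟧} (hf : constantCoeff f = 0) {n N : ℕ} (h : n ≤ N) :
    ((coeff n (truncExp f N) : ℝ≥0) : ℝ≥0∞) =
      ∑' k : ℕ, ((k.factorial : ℝ≥0)⁻¹ : ℝ≥0) * ((coeff n (f ^ k) : ℝ≥0) : ℝ≥0∞) := by
  rw [tsum_eq_sum (s := Finset.range (N + 1)), truncExp, map_sum]
  · push_cast
    refine Finset.sum_congr rfl fun k _ => ?_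
    rw [coeff_C_mul]
    push_cast
    rfl
  · intro k hk
    rw [coeff_pow_of_lt hf]
    · simp
    · simp at hk
      omega

/-- A sequence with logarithmic derivative `m` has generating function the exponential of that
of `m n / n`. -/
theorem tsum_eq_eexp (w m : ℕ → ℝ≥0) (hw : w 0 = 1) (hm : m 0 = 0)
    (h : ∀ n : ℕ, (n : ℝ≥0) * w n =
      ∑ p ∈ Finset.HasAntidiagonal.antidiagonal n, w p.1 * m p.2)
    (z : ℝ≥0) :
    ∑' n, (w n : ℝ≥0∞) * (z : ℝ≥0∞) ^ n =
      eexp (∑' n, ((m n / n : ℝ≥0) : ℝ≥0∞) * (z : ℝ≥0∞) ^ n) := by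
  set f : ℝ≥0⟦X⟧ := PowerSeries.mk fun n => m n / n with hfdef
  have hf : constantCoeff f = 0 := by simp [hfdef]
  have hXf : X * d⁄dX ℝ≥0 f = PowerSeries.mk m := by
    ext n
    cases n with
    | zero => simp [hm]
    | succ n =>
      rw [coeff_succ_X_mul, coeff_derivative, hfdef, coeff_mk, coeff_mk]
      have : (n : ℝ≥0) + 1 ≠ 0 := by positivity
      push_cast
      field_simp
  have key : ∀ n N, n ≤ N → w n = coeff n (truncExp f N) := by
    intro n
    induction n using Nat.strong_induction_on with
    | _ n ih =>
      intro N hN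
      cases n with
      | zero =>
        rw [hw, truncExp, Finset.sum_range_succ']
        simp [hf]
      | succ n =>
        obtain ⟨N, rfl⟩ : ∃ N', N = N' + 1 := ⟨N - 1, by omega⟩
        have h1 := congrArg (coeff (n + 1)) (X_mul_derivative_truncExp f N)
        rw [coeff_succ_X_mul, coeff_derivative, hXf, coeff_mul] at h1
        have h2 : ((n + 1 : ℕ) : ℝ≥0) * w (n + 1) =
            coeff (n + 1) (truncExp f (N + 1)) * (n + 1) := by
          rw [h, h1]
          refine Finset.sum_congr rfl fun p hp => ?_
          rw [Finset.HasAntidiagonal.mem_antidiagonal] at hp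
          rw [coeff_mk]
          by_cases hp2 : p.2 = 0
          · simp [hp2, hm]
          · rw [ih p.1 (by omega) N (by omega)]
        rw [mul_comm] at h2
        have h3 : ((n : ℝ≥0) + 1) ≠ 0 := by positivity
        push_cast at h2
        exact mul_right_cancel₀ h3 h2
  have hev : ∑' n, ((m n / n : ℝ≥0) : ℝ≥0∞) * (z : ℝ≥0∞) ^ n = evalSeries z f := by
    simp [evalSeries, hfdef]
  rw [hev, eexp_eq_tsum]
  simp only [← evalSeries_pow]
  simp only [evalSeries, ← ENNReal.tsum_mul_left]
  rw [ENNReal.tsum_comm]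
  refine tsum_congr fun n => ?_
  rw [key n n le_rfl, coeff_truncExp hf le_rfl, ← ENNReal.tsum_mul_right]
  refine tsum_congr fun k => ?_
  ring

theorem eexp_eq_EReal_exp (x : ℝ≥0∞) : eexp x = EReal.exp (x : EReal) := by
  by_cases hx : x = ⊤
  · simp [eexp, hx]
  · lift x to ℝ≥0 using hx
    rw [eexp, if_neg (by simp)]
    rfl

theorem eexp_mono : Monotone eexp := by
  intro x y h
  rw [eexp_eq_EReal_exp, eexp_eq_EReal_exp]
  exact EReal.exp_monotone (by exact_mod_cast h)

theorem continuous_eexp : Continuous eexp := by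
  have : eexp = fun x : ℝ≥0∞ => EReal.exp (x : EReal) := funext eexp_eq_EReal_exp
  rw [this]
  exact ENNReal.continuous_exp.comp continuous_coe_ennreal_ereal

end Exponential

section FiniteVolume

open PowerSeries

variable {α : Type*} [DecidableEq α] (r : α → α → Prop) (lam : List α → ℝ≥0)

/-- The total weight of the closed walks with `n ≥ 1` steps in `D` that visit `η`. -/
def hitMass (D : Finset α) (η : List α) (n : ℕ) : ℝ≥0 :=
  if n = 0 then 0 else
    ∑ l ∈ listsOf D (n + 1),
      if l.head? = l.getLast? ∧ ∃ x ∈ l, x ∈ η then listWt r lam l else 0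

theorem sum_massLE_singleton (D : Finset α) (n : ℕ) :
    ∑ y ∈ D, massLE r lam D (n + 1) [y] =
      ∑ l ∈ listsOf D (n + 1), if l.head? = l.getLast? then listWt r lam l else 0 := by
  simp only [massLE]
  rw [Finset.sum_comm]
  refine Finset.sum_congr rfl fun l hl => ?_
  obtain ⟨hlen, hD⟩ := mem_listsOf.1 hl
  obtain ⟨x, l, rfl⟩ := List.exists_cons_of_length_eq_add_one hlen
  simp only [LE_eq_singleton_iff]
  rw [Finset.sum_eq_single x]
  · simp [eq_comm]
  · intro y _ hy
    rw [if_neg]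
    simp [hy.symm]
  · intro hx
    exact absurd (hD x (by simp)) hx

theorem sum_massLE_singleton_eq_add (D : Finset α) (η : List α) {n : ℕ} (hn : n ≠ 0) :
    ∑ y ∈ D, massLE r lam D (n + 1) [y] =
      ∑ y ∈ D \ η.toFinset, massLE r lam (D \ η.toFinset) (n + 1) [y] + hitMass r lam D η n := by
  have h : listsOf (D \ η.toFinset) (n + 1) =
      (listsOf D (n + 1)).filter (fun l => ¬ ∃ x ∈ l, x ∈ η) := by
    ext l
    simp only [mem_listsOf, Finset.mem_filter, Finset.mem_sdiff, List.mem_toFinset]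
    grind
  rw [sum_massLE_singleton, sum_massLE_singleton, hitMass, if_neg hn, h, Finset.sum_filter,
    ← Finset.sum_add_distrib]
  refine Finset.sum_congr rfl fun l _ => ?_
  by_cases h1 : l.head? = l.getLast? <;> by_cases h2 : ∃ x ∈ l, x ∈ η <;> simp [h1, h2]

variable {r lam}

theorem coeff_sum_seriesLE_sub
    (hrot : ∀ p k, List.Nodup p → cycWt r lam (p.rotate k) = cycWt r lam p) (D : Finset α)
    (η : List α) (n : ℕ) :
    coeff n (∑ y ∈ D, (seriesLE r lam D [y] - 1) -
      ∑ y ∈ D \ η.toFinset, (seriesLE r lam (D \ η.toFinset) [y] - 1)) =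
      (hitMass r lam D η n : ℝ) := by
  rw [map_sub, map_sum, map_sum]
  cases n with
  | zero =>
    have h : ∀ E : Finset α, ∑ y ∈ E, coeff 0 (seriesLE r lam E [y] - 1) = 0 := by
      intro E
      refine Finset.sum_eq_zero fun y hy => ?_
      rw [coeff_zero_eq_constantCoeff, map_sub,
        constantCoeff_seriesLE hrot E (by simp) (by simp) (by simpa)]
      simp
    rw [h, h]
    simp [hitMass]
  | succ n =>
    have h : ∀ E : Finset α, ∑ y ∈ E, coeff (n + 1) (seriesLE r lam E [y] - 1) =
        ((∑ y ∈ E, massLE r lam E (n + 1 + 1) [y] : ℝ≥0) : ℝ) := by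
      intro E
      push_cast
      refine Finset.sum_congr rfl fun y _ => ?_
      simp [seriesLE, coeff_one]
    rw [h, h, sum_massLE_singleton_eq_add r lam D η n.succ_ne_zero]
    push_cast
    ring

theorem natCast_mul_massLE
    (hrot : ∀ p k, List.Nodup p → cycWt r lam (p.rotate k) = cycWt r lam p) (D : Finset α)
    {η : List α} (hη : η.Nodup) (hr : η.IsChain r) (hD : ∀ x ∈ η, x ∈ D) (n : ℕ) :
    (n : ℝ≥0) * massLE r lam D (n + η.length) η =
      ∑ p ∈ Finset.HasAntidiagonal.antidiagonal n,
        massLE r lam D (p.1 + η.length) η * hitMass r lam D η p.2 := by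
  have h := congrArg (coeff n) (X_mul_derivative_seriesLE hrot D hη hr hD)
  rw [coeff_mul n (seriesLE r lam D η)] at h
  simp only [coeff_sum_seriesLE_sub hrot] at h
  apply NNReal.coe_injective
  push_cast
  simp only [seriesLE, coeff_mk] at h
  rw [← h]
  cases n with
  | zero => simp
  | succ n =>
    rw [coeff_succ_X_mul, coeff_derivative, coeff_mk]
    push_cast
    ring

theorem massLE_length
    (hrot : ∀ p k, List.Nodup p → cycWt r lam (p.rotate k) = cycWt r lam p) (D : Finset α)
    {η : List α} (hη : η.Nodup) (hr : η.IsChain r) (hD : ∀ x ∈ η, x ∈ D) :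
    massLE r lam D η.length η = 1 := by
  have h := constantCoeff_seriesLE hrot D hη hr hD
  rw [← coeff_zero_eq_constantCoeff_apply, seriesLE, coeff_mk, zero_add] at h
  exact_mod_cast h

/-- The loop measure representation in a finite volume. -/
theorem tsum_massLE_eq_eexp
    (hrot : ∀ p k, List.Nodup p → cycWt r lam (p.rotate k) = cycWt r lam p) (D : Finset α)
    {η : List α} (hη : η.Nodup) (hr : η.IsChain r) (hD : ∀ x ∈ η, x ∈ D) (z : ℝ≥0) :
    ∑' n, (massLE r lam D (n + η.length) η : ℝ≥0∞) * (z : ℝ≥0∞) ^ n =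
      eexp (∑' n : ℕ, ((hitMass r lam D η n / n : ℝ≥0) : ℝ≥0∞) * (z : ℝ≥0∞) ^ n) :=
  tsum_eq_eexp _ _ (by rw [zero_add, massLE_length hrot D hη hr hD]) (by simp [hitMass])
    (natCast_mul_massLE hrot D hη hr hD) z

end FiniteVolume

section Lattice

theorem isChain_rotate_append_take_one {α : Type*} {r : α → α → Prop} {p : List α}
    (h : (p ++ p.take 1).IsChain r) (k : ℕ) :
    (p.rotate k ++ (p.rotate k).take 1).IsChain r := by
  induction k with
  | zero => simpa
  | succ k ih =>
    rw [← List.rotate_rotate]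
    generalize p.rotate k = q at ih
    cases q with
    | nil => simp
    | cons a t =>
      cases t with
      | nil => simpa using ih
      | cons b s =>
        simp only [List.rotate_cons_succ, List.rotate_zero, List.cons_append, List.take_succ_cons,
          List.take_zero] at ih ⊢
        rw [List.isChain_cons_cons] at ih
        have := ih.2.append_overlap (l₁ := b :: s) (l₂ := [a]) (l₃ := [b])
          (by simpa using ih.1) (by simp)
        simpa using this

theorem cycWt_rotate {d : ℕ} {lam : List (Pt d) → ℝ≥0} (hsym : SymmAssumption lam)
    (p : List (Pt d)) (k : ℕ) (hp : p.Nodup) :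
    cycWt Adj lam (p.rotate k) = cycWt Adj lam p := by
  match p with
  | [] => simp
  | [a] => simp
  | a :: b :: s =>
    set p := a :: b :: s with hpdef
    have hiff : (p.rotate k ++ (p.rotate k).take 1).IsChain Adj ↔
        (p ++ p.take 1).IsChain Adj := by
      refine ⟨fun h => ?_, fun h => isChain_rotate_append_take_one h k⟩
      obtain ⟨n, hn⟩ := (List.IsRotated.symm ⟨k, rfl⟩ : p.rotate k ~r p)
      have := isChain_rotate_append_take_one h n
      rwa [hn] at this
    rw [cycWt, cycWt]
    by_cases hc : (p ++ p.take 1).IsChain Adj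
    · rw [if_pos hc, if_pos (hiff.2 hc)]
      have hdrop : (p ++ p.take 1).dropLast = p := by
        rw [show p.take 1 = [a] from rfl, List.dropLast_concat]
      have hsap : IsSAPList (p ++ p.take 1) :=
        ⟨hc, by simp [hpdef], by rw [show p.take 1 = [a] from rfl, List.getLastD_concat]; rfl,
          by rwa [hdrop]⟩
      rw [← hsym.2.1 _ hsap k, polyRot, hdrop]
      congr 2
      have hne : p.rotate k ≠ [] := by simp [hpdef]
      obtain ⟨x, t, hx⟩ := List.exists_cons_of_ne_nil hne
      rw [hx]
      simp
    · rw [if_neg hc, if_neg fun h => hc (hiff.1 h)]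

theorem tsum_walk_eq {d : ℕ} (D : Finset (Pt d)) (f : List (Pt d) → ℝ≥0∞) (h0 : f [] = 0)
    (hc : ∀ l, ¬ l.IsChain Adj → f l = 0) :
    (∑' ω : Walk d, if ∀ x ∈ ω.pts, x ∈ D then f ω.pts else 0) =
      ∑' n, ∑ l ∈ listsOf D n, f l := by
  have hinj : Function.Injective (Walk.pts : Walk d → List (Pt d)) := by
    rintro ⟨l, _, _⟩ ⟨l', _, _⟩ h
    simpa using h
  rw [hinj.tsum_eq (f := fun l : List (Pt d) => if ∀ x ∈ l, x ∈ D then f l else 0)]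
  · have h1 : ∀ n, ∑ l ∈ listsOf D n, f l =
        ∑' l : List (Pt d), if l.length = n ∧ ∀ x ∈ l, x ∈ D then f l else 0 := by
      intro n
      rw [tsum_eq_sum (s := listsOf D n)]
      · refine Finset.sum_congr rfl fun l hl => ?_
        rw [if_pos (mem_listsOf.1 hl)]
      · intro l hl
        rw [if_neg fun h => hl (mem_listsOf.2 h)]
    simp only [h1]
    rw [ENNReal.tsum_comm]
    refine tsum_congr fun l => ?_
    rw [tsum_eq_single l.length]
    · simp
    · intro n hn
      simp [hn.symm]
  · intro l hl
    by_cases hne : l = []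
    · subst hne
      simp [h0] at hl
    · by_cases hch : l.IsChain Adj
      · exact ⟨⟨l, hne, hch⟩, rfl⟩
      · simp [hc l hch] at hl

theorem wt_eq {d : ℕ} (lam : List (Pt d) → ℝ≥0) (z : ℝ≥0) (ω : Walk d) :
    wt lam z ω = (z : ℝ≥0∞) ^ (ω.pts.length - 1) * (listWt Adj lam ω.pts : ℝ≥0∞) := by
  have hc : ω.pts.IsChain Adj := ω.chain
  rw [wt, wt0, Walk.len, listWt, if_pos hc]
  change _ = _ * ENNReal.ofNNRealHom _
  rw [map_multiset_prod, Multiset.map_map]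
  rfl

theorem Walk.isLoop_iff {d : ℕ} (ω : Walk d) :
    ω.IsLoop ↔ 2 ≤ ω.pts.length ∧ ω.pts.head? = ω.pts.getLast? := by
  obtain ⟨l, hne, hch⟩ := ω
  obtain ⟨a, t, rfl⟩ := List.exists_cons_of_ne_nil hne
  simp only [Walk.IsLoop, Walk.len, Walk.start, Walk.finish, List.headI, List.head?_cons,
    List.getLastD_eq_getLast?]
  rw [List.getLast?_eq_some_getLast hne]
  simp [eq_comm]

theorem wbar_finite_volume {d : ℕ} (lam : List (Pt d) → ℝ≥0) (z : ℝ≥0) (η : Walk d)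
    (D : Finset (Pt d)) :
    (∑' ω : Walk d, if ∀ x ∈ ω.pts, x ∈ D then
        (if LE ω.pts = η.pts then wt lam z ω else 0) else 0) =
      (z : ℝ≥0∞) ^ η.len *
        ∑' n, (massLE Adj lam D (n + η.pts.length) η.pts : ℝ≥0∞) * (z : ℝ≥0∞) ^ n := by
  have hpos : 0 < η.pts.length := List.length_pos_iff.2 η.ne
  simp only [wt_eq]
  rw [tsum_walk_eq D (fun l => if LE l = η.pts then
    (z : ℝ≥0∞) ^ (l.length - 1) * (listWt Adj lam l : ℝ≥0∞) else 0)]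
  · have h1 : ∀ n, (∑ l ∈ listsOf D n, if LE l = η.pts then
        (z : ℝ≥0∞) ^ (l.length - 1) * (listWt Adj lam l : ℝ≥0∞) else 0) =
        (z : ℝ≥0∞) ^ (n - 1) * (massLE Adj lam D n η.pts : ℝ≥0∞) := by
      intro n
      rw [massLE]
      push_cast
      rw [Finset.mul_sum]
      refine Finset.sum_congr rfl fun l hl => ?_
      rw [(mem_listsOf.1 hl).1]
      split_ifs <;> simp
    simp only [h1]
    rw [← ENNReal.tsum_mul_left, ← (add_left_injective η.pts.length).tsum_eq]
    · refine tsum_congr fun n => ?_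
      rw [Walk.len, show n + η.pts.length - 1 = (η.pts.length - 1) + n by omega, pow_add]
      ring
    · intro n hn
      rw [Function.mem_support] at hn
      by_cases h : n < η.pts.length
      · rw [massLE_of_length_lt _ _ _ _ _ h] at hn
        simp at hn
      · exact ⟨n - η.pts.length, by simp; omega⟩
  · simp [Ne.symm η.ne]
  · intro l hl
    simp [listWt, hl]

theorem mu_finite_volume {d : ℕ} (lam : List (Pt d) → ℝ≥0) (z : ℝ≥0) (η : Walk d)
    (D : Finset (Pt d)) :
    (∑' ω : Walk d, if ∀ x ∈ ω.pts, x ∈ D then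
        (if ω.IsLoop ∧ (ω.range ∩ η.range).Nonempty ∧ ω.range ∩ ∅ = ∅
          then wt lam z ω / (ω.len : ℝ≥0∞) else 0) else 0) =
      ∑' n : ℕ, ((hitMass Adj lam D η.pts n / n : ℝ≥0) : ℝ≥0∞) * (z : ℝ≥0∞) ^ n := by
  have hcond : ∀ ω : Walk d, (ω.IsLoop ∧ (ω.range ∩ η.range).Nonempty ∧ ω.range ∩ ∅ = ∅) ↔
      2 ≤ ω.pts.length ∧ ω.pts.head? = ω.pts.getLast? ∧ ∃ x ∈ ω.pts, x ∈ η.pts := by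
    intro ω
    rw [ω.isLoop_iff, and_assoc]
    simp only [Set.inter_empty, and_true]
    rfl
  simp only [hcond, wt_eq, Walk.len]
  rw [tsum_walk_eq D (fun l => if 2 ≤ l.length ∧ l.head? = l.getLast? ∧ ∃ x ∈ l, x ∈ η.pts then
    (z : ℝ≥0∞) ^ (l.length - 1) * (listWt Adj lam l : ℝ≥0∞) / ((l.length - 1 : ℕ) : ℝ≥0∞) else 0)]
  · rw [tsum_eq_zero_add' ENNReal.summable]
    have h0 : ∀ l ∈ listsOf D 0, l = [] := by simp [listsOf]
    rw [Finset.sum_eq_zero, zero_add]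
    · refine tsum_congr fun n => ?_
      by_cases hn : n = 0
      · subst hn
        simp only [hitMass, if_true]
        rw [Finset.sum_eq_zero]
        · simp
        · intro l hl
          rw [(mem_listsOf.1 hl).1]
          simp
      · have hn' : (n : ℝ≥0) ≠ 0 := by exact_mod_cast hn
        rw [hitMass, if_neg hn, ENNReal.coe_div hn']
        push_cast
        rw [div_eq_mul_inv, Finset.sum_mul, Finset.sum_mul]
        refine Finset.sum_congr rfl fun l hl => ?_
        rw [(mem_listsOf.1 hl).1]
        have h2 : 2 ≤ n + 1 := by omega
        simp only [h2, true_and, Nat.add_sub_cancel, Nat.cast_add, Nat.cast_one,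
          ENNReal.add_sub_cancel_right ENNReal.one_ne_top]
        split_ifs
        · rw [div_eq_mul_inv]
          ring
        · simp
    · intro l hl
      simp [h0 l hl]
  · simp
  · intro l hl
    simp [listWt, hl]

theorem tsum_walk_eq_iSup {d : ℕ} (D₀ : Finset (Pt d)) (f : Walk d → ℝ≥0∞) :
    ∑' ω, f ω = ⨆ D : Finset (Pt d), ∑' ω, if ∀ x ∈ ω.pts, x ∈ D ∪ D₀ then f ω else 0 := by
  apply le_antisymm
  · rw [ENNReal.tsum_eq_iSup_sum]
    refine iSup_le fun s => ?_
    refine le_trans ?_ (le_iSup _ (s.biUnion fun ω => ω.pts.toFinset))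
    refine le_trans (le_of_eq ?_) (ENNReal.sum_le_tsum s)
    refine Finset.sum_congr rfl fun ω hω => ?_
    rw [if_pos]
    intro x hx
    exact Finset.mem_union_left _ (Finset.mem_biUnion.2 ⟨ω, hω, List.mem_toFinset.2 hx⟩)
  · refine iSup_le fun D => ENNReal.tsum_le_tsum fun ω => ?_
    split_ifs <;> simp

end Lattice

/-- **Loop measure representation of λ-LWW.**  Let `λ` be nonnegative loop activities
satisfying the symmetry assumption and let `z ≥ 0`.  For every self-avoiding walk `η`
on ℤ^d, `w̄_{λ,z}(η) = Σ_{ω : LE(ω) = η} w_{λ,z}(ω) = z^{|η|}·exp(μ_{λ,z}(range η))`,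
as an identity in `[0,∞]` (with `exp ∞ = ∞`). -/
theorem loop_measure_representation {d : ℕ} (lam : List (Pt d) → ℝ≥0) (z : ℝ≥0)
    (hsym : SymmAssumption lam) (η : Walk d) (hη : η.pts.Nodup) :
    wbar lam z η = (z : ℝ≥0∞) ^ η.len * eexp (mu lam z η.range ∅) := by
  rw [wbar, mu, tsum_walk_eq_iSup η.pts.toFinset, tsum_walk_eq_iSup η.pts.toFinset,
    eexp_mono.map_ciSup_of_continuousAt continuous_eexp.continuousAt (OrderTop.bddAbove _), ENNReal.mul_iSup]
  refine iSup_congr fun D => ?_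
  rw [wbar_finite_volume, mu_finite_volume, tsum_massLE_eq_eexp (cycWt_rotate hsym) _ hη η.chain]
  intro x hx
  exact Finset.mem_union_right _ (List.mem_toFinset.2 hx)

end LWW
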